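/- Let A be a split regular BiHom-Poisson superalgebra with root system Λ. For any [α] ∈ Λ/∼, the linear subspace I_{[α]} = I_{H,[α]} ⊕ V_{[α]} is an ideal of A, i.e. [I_{[α]}, A] + I_{[α]}·A + A·I_{[α]} ⊆ I_{[α]} and φ(I_{[α]}) = ψ(I_{[α]}) = I_{[α]}. -/

import Mathlib

/-- A (regular, with distinguished maximal abelian graded subalgebra `H`)
BiHom-Poisson superalgebra over a field `K`. -/
structure BHPS (K A : Type*) [Field K] [AddCommGroup A] [Module K A] where
  /-- the ℤ₂-grading -/
  grade : ZMod 2 → Submodule K A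
  gradeInternal : DirectSum.IsInternal grade
  /-- the bracket -/
  br : A →ₗ[K] A →ₗ[K] A
  /-- the associative-type product -/
  mu : A →ₗ[K] A →ₗ[K] A
  /-- the first structure map -/
  phi : A ≃ₗ[K] A
  /-- the second structure map -/
  psi : A ≃ₗ[K] A
  br_grade : ∀ (i j : ZMod 2), ∀ x ∈ grade i, ∀ y ∈ grade j, br x y ∈ grade (i + j)
  mu_grade : ∀ (i j : ZMod 2), ∀ x ∈ grade i, ∀ y ∈ grade j, mu x y ∈ grade (i + j)
  phi_grade : ∀ i, (grade i).map (phi : A →ₗ[K] A) = grade i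
  psi_grade : ∀ i, (grade i).map (psi : A →ₗ[K] A) = grade i
  phi_psi_comm : ∀ x, phi (psi x) = psi (phi x)
  phi_br : ∀ x y, phi (br x y) = br (phi x) (phi y)
  psi_br : ∀ x y, psi (br x y) = br (psi x) (psi y)
  phi_mu : ∀ x y, phi (mu x y) = mu (phi x) (phi y)
  psi_mu : ∀ x y, psi (mu x y) = mu (psi x) (psi y)
  skew : ∀ (i j : ZMod 2), ∀ x ∈ grade i, ∀ y ∈ grade j,
    br (psi x) (phi y) = -((-1 : K) ^ (i.val * j.val)) • br (psi y) (phi x)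
  jacobi : ∀ (i j k : ZMod 2), ∀ x ∈ grade i, ∀ y ∈ grade j, ∀ z ∈ grade k,
    ((-1 : K) ^ (i.val * k.val)) • br (psi (psi x)) (br (psi y) (phi z))
      + ((-1 : K) ^ (i.val * j.val)) • br (psi (psi y)) (br (psi z) (phi x))
      + ((-1 : K) ^ (j.val * k.val)) • br (psi (psi z)) (br (psi x) (phi y)) = 0
  assoc : ∀ x y z, mu (phi x) (mu y z) = mu (mu x y) (psi z)
  leibniz : ∀ (j k : ZMod 2), ∀ (x : A), ∀ y ∈ grade j, ∀ z ∈ grade k,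
    br (mu x y) (phi (psi z))
      = mu (phi x) (br y (phi z)) + ((-1 : K) ^ (j.val * k.val)) • mu (br x (psi z)) (phi y)
  /-- the maximal abelian graded subalgebra -/
  H : Submodule K A
  H_graded : H = (H ⊓ grade 0) ⊔ (H ⊓ grade 1)
  H_abelian : ∀ x ∈ H, ∀ y ∈ H, br x y = 0
  phi_H : H.map (phi : A →ₗ[K] A) = H
  psi_H : H.map (psi : A →ₗ[K] A) = H
  H_max : ∀ H' : Submodule K A, H ≤ H' →
    H' = (H' ⊓ grade 0) ⊔ (H' ⊓ grade 1) →
    (∀ x ∈ H', ∀ y ∈ H', br x y = 0) →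
    H'.map (phi : A →ₗ[K] A) = H' → H'.map (psi : A →ₗ[K] A) = H' → H' = H

namespace BHPS

variable {K A : Type*} [Field K] [AddCommGroup A] [Module K A] (D : BHPS K A)

/-- The even part `H₀` of `H`. -/
def H0 : Submodule K A := D.H ⊓ D.grade 0

lemma phi_H0 : D.H0.map (D.phi : A →ₗ[K] A) = D.H0 := by
  unfold H0
  rw [Submodule.map_inf (D.phi : A →ₗ[K] A) D.phi.injective, D.phi_H, D.phi_grade]

lemma psi_H0 : D.H0.map (D.psi : A →ₗ[K] A) = D.H0 := by
  unfold H0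
  rw [Submodule.map_inf (D.psi : A →ₗ[K] A) D.psi.injective, D.psi_H, D.psi_grade]

/-- The restriction of `φ` to `H₀`, as a linear automorphism. -/
def phiH0 : ↥D.H0 ≃ₗ[K] ↥D.H0 :=
  (D.phi.submoduleMap D.H0).trans (LinearEquiv.ofEq _ _ D.phi_H0)

/-- The restriction of `ψ` to `H₀`, as a linear automorphism. -/
def psiH0 : ↥D.H0 ≃ₗ[K] ↥D.H0 :=
  (D.psi.submoduleMap D.H0).trans (LinearEquiv.ofEq _ _ D.psi_H0)

/-- The root space attached to a linear functional `α : H₀ → K`: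
`A_α = {v : [h, φ(v)] = α(h) • φψ(v) for all h ∈ H₀}`. -/
def rootSpace (α : Module.Dual K ↥D.H0) : Submodule K A where
  carrier := {v | ∀ h : ↥D.H0, D.br (h : A) (D.phi v) = α h • D.phi (D.psi v)}
  add_mem' := by
    intro a b ha hb h
    simp only [map_add, ha h, hb h, smul_add]
  zero_mem' := by
    intro h
    simp
  smul_mem' := by
    intro c v hv h
    simp only [map_smul, hv h]
    rw [smul_comm]

/-- The root system `Λ`. -/
def roots : Set (Module.Dual K ↥D.H0) := {α | α ≠ 0 ∧ D.rootSpace α ≠ ⊥}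

/-- `A` is split with respect to `H`: `A = H ⊕ (⊕_{α ∈ Λ} A_α)`. -/
def IsSplit : Prop :=
  letI := Classical.decEq (Option ↥D.roots)
  DirectSum.IsInternal (fun o : Option ↥D.roots => o.elim D.H fun α => D.rootSpace α.1)

/-- `α ∘ φ^{z₁} ∘ ψ^{z₂}`. -/
def twist (z₁ z₂ : ℤ) (γ : Module.Dual K ↥D.H0) : Module.Dual K ↥D.H0 :=
  γ ∘ₗ ((((D.phiH0 ^ z₁) : ↥D.H0 ≃ₗ[K] ↥D.H0) : ↥D.H0 →ₗ[K] ↥D.H0) ∘ₗ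
        (((D.psiH0 ^ z₂) : ↥D.H0 ≃ₗ[K] ↥D.H0) : ↥D.H0 →ₗ[K] ↥D.H0))

/-- `±S = S ∪ (-S)`. -/
def pm (S : Set (Module.Dual K ↥D.H0)) : Set (Module.Dual K ↥D.H0) :=
  S ∪ (Neg.neg '' S)

/-- The partial sums `α₁∘φ^{-i} + α₂∘φ^{-i+1}∘ψ^{-1} + ⋯ + α_i∘φ^{-1}∘ψ^{-1} + α_{i+1}∘ψ^{-1}`
appearing in the definition of a connection. -/
def chainSum (a : ℕ → Module.Dual K ↥D.H0) (i : ℕ) : Module.Dual K ↥D.H0 :=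
  D.twist (-(i : ℤ)) 0 (a 1)
    + ∑ t ∈ Finset.Icc 2 (i + 1), D.twist (-((i : ℤ) + 1 - (t : ℤ))) (-1) (a t)

/-- `a 1, …, a k` is a connection from `α` to `β` (relative to the set of roots `S`). -/
def IsConnectionIn (S : Set (Module.Dual K ↥D.H0)) (α β : Module.Dual K ↥D.H0)
    (k : ℕ) (a : ℕ → Module.Dual K ↥D.H0) : Prop :=
  2 ≤ k ∧
  (∀ t, 1 ≤ t → t ≤ k → a t ∈ D.pm S) ∧
  (∃ n r : ℕ, a 1 = D.twist (-(n : ℤ)) (-(r : ℤ)) α) ∧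
  (∀ i, 1 ≤ i → i ≤ k - 2 → D.chainSum a i ∈ D.pm S) ∧
  (∃ m s : ℕ, D.chainSum a (k - 1) = D.twist (-(m : ℤ)) (-(s : ℤ)) β
      ∨ D.chainSum a (k - 1) = -(D.twist (-(m : ℤ)) (-(s : ℤ)) β))

/-- `α` is connected to `β` (relative to the set of roots `S`). -/
def ConnectedIn (S : Set (Module.Dual K ↥D.H0)) (α β : Module.Dual K ↥D.H0) : Prop :=
  (∃ z₁ z₂ : ℤ, ∃ ε : K, (ε = 1 ∨ ε = -1) ∧ β = ε • D.twist z₁ z₂ α) ∨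
  (∃ k a, D.IsConnectionIn S α β k a)

/-- `α` is connected to `β`. -/
def Connected (α β : Module.Dual K ↥D.H0) : Prop := D.ConnectedIn D.roots α β

/-- The set `[α]` of roots connected to `α`. -/
def classSet (α : Module.Dual K ↥D.H0) : Set (Module.Dual K ↥D.H0) :=
  {β ∈ D.roots | D.Connected α β}

/-- `I_{H,[α]} = span {[A_{β∘ψ⁻¹}, A_{−β∘φ⁻¹}] + A_{β∘ψ⁻¹}·A_{−β∘φ⁻¹} : β ∈ [α]}`. -/
def IH (α : Module.Dual K ↥D.H0) : Submodule K A :=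
  ⨆ β ∈ D.classSet α,
    (Submodule.map₂ D.br (D.rootSpace (D.twist 0 (-1) β)) (D.rootSpace (-(D.twist (-1) 0 β)))
      ⊔ Submodule.map₂ D.mu (D.rootSpace (D.twist 0 (-1) β)) (D.rootSpace (-(D.twist (-1) 0 β))))

/-- `V_{[α]} = ⊕_{β ∈ [α]} A_β`. -/
def VS (α : Module.Dual K ↥D.H0) : Submodule K A :=
  ⨆ β ∈ D.classSet α, D.rootSpace β

/-- `I_{[α]} = I_{H,[α]} ⊕ V_{[α]}`. -/
def Iclass (α : Module.Dual K ↥D.H0) : Submodule K A := D.IH α ⊔ D.VS α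

/-- `J` is an ideal of the (sub)algebra `I`. -/
def IsIdealIn (J I : Submodule K A) : Prop :=
  J ≤ I ∧ J = (J ⊓ D.grade 0) ⊔ (J ⊓ D.grade 1) ∧
  Submodule.map₂ D.br J I ≤ J ∧ Submodule.map₂ D.mu J I ≤ J ∧ Submodule.map₂ D.mu I J ≤ J ∧
  J.map (D.phi : A →ₗ[K] A) = J ∧ J.map (D.psi : A →ₗ[K] A) = J

/-- `I` is an ideal of `A`: `[I,A] + I·A + A·I ⊆ I`, graded and `φ,ψ`-invariant. -/
def IsIdeal (I : Submodule K A) : Prop := D.IsIdealIn I ⊤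

/-- `A` is simple: `[A,A] + A·A ≠ 0` and its only ideals are `0` and `A`. -/
def IsSimple : Prop :=
  (Submodule.map₂ D.br ⊤ ⊤ ⊔ Submodule.map₂ D.mu (⊤ : Submodule K A) ⊤ ≠ ⊥) ∧
  ∀ I : Submodule K A, D.IsIdeal I → I = ⊥ ∨ I = ⊤

/-- The center `Z(A) = {v : [v,A] + v·A + A·v = 0}`. -/
def center : Submodule K A where
  carrier := {v | ∀ w, D.br v w = 0 ∧ D.mu v w = 0 ∧ D.mu w v = 0}
  add_mem' := by
    intro a b ha hb w
    obtain ⟨h1, h2, h3⟩ := ha w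
    obtain ⟨g1, g2, g3⟩ := hb w
    simp [map_add, LinearMap.add_apply, h1, h2, h3, g1, g2, g3]
  zero_mem' := by intro w; simp
  smul_mem' := by
    intro c v hv w
    obtain ⟨h1, h2, h3⟩ := hv w
    simp [map_smul, LinearMap.smul_apply, h1, h2, h3]

/-- `Σ_{α∈Λ} ([A_{α∘ψ⁻¹}, A_{−α∘φ⁻¹}] + A_{α∘ψ⁻¹}·A_{−α∘φ⁻¹})`. -/
def HSum : Submodule K A :=
  ⨆ α ∈ D.roots,
    (Submodule.map₂ D.br (D.rootSpace (D.twist 0 (-1) α)) (D.rootSpace (-(D.twist (-1) 0 α)))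
      ⊔ Submodule.map₂ D.mu (D.rootSpace (D.twist 0 (-1) α)) (D.rootSpace (-(D.twist (-1) 0 α))))

/-- The root system is symmetric. -/
def IsSymmetric : Prop := ∀ α ∈ D.roots, -α ∈ D.roots

/-- `A` is root multiplicative. -/
def RootMultiplicative : Prop :=
  ∀ (i j : ZMod 2) (α β : Module.Dual K ↥D.H0), α ∈ D.roots → β ∈ D.roots →
    D.rootSpace α ⊓ D.grade i ≠ ⊥ → D.rootSpace β ⊓ D.grade j ≠ ⊥ →
    (D.twist 0 (-1) α + D.twist (-1) 0 β) ∈ D.roots →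
    D.rootSpace (D.twist 0 (-1) α + D.twist (-1) 0 β) ⊓ D.grade (i + j) ≠ ⊥ →
    Submodule.map₂ D.br (D.rootSpace α ⊓ D.grade i) (D.rootSpace β ⊓ D.grade j)
      ⊔ Submodule.map₂ D.mu (D.rootSpace α ⊓ D.grade i) (D.rootSpace β ⊓ D.grade j) ≠ ⊥

/-- `A` is of maximal length: every nonzero graded root space is one-dimensional. -/
def MaximalLength : Prop :=
  ∀ (i : ZMod 2), ∀ α ∈ D.roots, D.rootSpace α ⊓ D.grade i ≠ ⊥ →
    Module.rank K ↥(D.rootSpace α ⊓ D.grade i) = 1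

end BHPS

namespace BHPS

variable {K A : Type*} [Field K] [AddCommGroup A] [Module K A] (D : BHPS K A)

/-! ### Twists of functionals -/

lemma coe_phiH0 (h : ↥D.H0) : (D.phiH0 h : A) = D.phi h := rfl

lemma coe_psiH0 (h : ↥D.H0) : (D.psiH0 h : A) = D.psi h := rfl

lemma commute_phiH0_psiH0 : Commute D.phiH0 D.psiH0 := by
  refine LinearEquiv.ext fun h => Subtype.ext ?_
  exact D.phi_psi_comm h

lemma twist_apply (z₁ z₂ : ℤ) (γ : Module.Dual K ↥D.H0) (h : ↥D.H0) :
    D.twist z₁ z₂ γ h = γ ((D.phiH0 ^ z₁ * D.psiH0 ^ z₂) h) := rfl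

lemma twist_add (z₁ z₂ : ℤ) (γ δ : Module.Dual K ↥D.H0) :
    D.twist z₁ z₂ (γ + δ) = D.twist z₁ z₂ γ + D.twist z₁ z₂ δ := rfl

lemma twist_neg (z₁ z₂ : ℤ) (γ : Module.Dual K ↥D.H0) :
    D.twist z₁ z₂ (-γ) = -D.twist z₁ z₂ γ := rfl

lemma twist_zero (z₁ z₂ : ℤ) : D.twist z₁ z₂ 0 = 0 := rfl

lemma twist_sum {ι : Type*} (z₁ z₂ : ℤ) (s : Finset ι) (f : ι → Module.Dual K ↥D.H0) :
    D.twist z₁ z₂ (∑ t ∈ s, f t) = ∑ t ∈ s, D.twist z₁ z₂ (f t) :=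
  LinearMap.ext fun h => by simp [twist_apply]

lemma twist_twist (z₁ z₂ w₁ w₂ : ℤ) (γ : Module.Dual K ↥D.H0) :
    D.twist z₁ z₂ (D.twist w₁ w₂ γ) = D.twist (z₁ + w₁) (z₂ + w₂) γ := by
  ext h
  simp only [twist_apply, ← LinearEquiv.mul_apply]
  congr 2
  have hc := (D.commute_phiH0_psiH0.zpow_zpow z₁ w₂).eq
  rw [add_comm z₁, add_comm z₂, zpow_add, zpow_add, mul_assoc, ← mul_assoc _ (D.phiH0 ^ z₁), ← hc]
  simp only [mul_assoc]

@[simp]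
lemma twist_zero_zero (γ : Module.Dual K ↥D.H0) : D.twist 0 0 γ = γ := by
  ext h
  simp [twist_apply]

lemma twist_apply_psiH0 (z₁ z₂ : ℤ) (γ : Module.Dual K ↥D.H0) (h : ↥D.H0) :
    D.twist z₁ z₂ γ (D.psiH0 h) = D.twist z₁ (z₂ + 1) γ h := by
  simp [twist_apply, zpow_add]

lemma twist_eq_iff (z₁ z₂ : ℤ) (γ δ : Module.Dual K ↥D.H0) :
    D.twist z₁ z₂ γ = δ ↔ γ = D.twist (-z₁) (-z₂) δ := by
  constructor <;> rintro rfl <;> simp [twist_twist]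

/-! ### Root spaces -/

lemma mem_rootSpace {γ : Module.Dual K ↥D.H0} {v : A} :
    v ∈ D.rootSpace γ ↔ ∀ h : ↥D.H0, D.br (h : A) (D.phi v) = γ h • D.phi (D.psi v) := Iff.rfl

lemma phi_mem_rootSpace_iff {γ : Module.Dual K ↥D.H0} {v : A} :
    D.phi v ∈ D.rootSpace γ ↔ v ∈ D.rootSpace (D.twist 1 0 γ) := by
  refine D.phiH0.surjective.forall.trans (forall_congr' fun h => ?_)
  rw [coe_phiH0, ← D.phi_br, ← D.phi_psi_comm, ← map_smul, D.phi.injective.eq_iff]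
  simp [twist_apply]

lemma psi_mem_rootSpace_iff {γ : Module.Dual K ↥D.H0} {v : A} :
    D.psi v ∈ D.rootSpace γ ↔ v ∈ D.rootSpace (D.twist 0 1 γ) := by
  refine D.psiH0.surjective.forall.trans (forall_congr' fun h => ?_)
  rw [coe_psiH0, D.phi_psi_comm v, ← D.psi_br, D.phi_psi_comm (D.psi v), ← map_smul,
    D.psi.injective.eq_iff]
  simp [twist_apply, D.phi_psi_comm v]

lemma phi_mem_rootSpace {γ : Module.Dual K ↥D.H0} {v : A} (hv : v ∈ D.rootSpace γ) :
    D.phi v ∈ D.rootSpace (D.twist (-1) 0 γ) := by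
  simpa [phi_mem_rootSpace_iff, twist_twist] using hv

lemma psi_mem_rootSpace {γ : Module.Dual K ↥D.H0} {v : A} (hv : v ∈ D.rootSpace γ) :
    D.psi v ∈ D.rootSpace (D.twist 0 (-1) γ) := by
  simpa [psi_mem_rootSpace_iff, twist_twist] using hv

lemma phi_symm_mem_rootSpace {γ : Module.Dual K ↥D.H0} {v : A} (hv : v ∈ D.rootSpace γ) :
    D.phi.symm v ∈ D.rootSpace (D.twist 1 0 γ) := by
  simpa [← phi_mem_rootSpace_iff] using hv

lemma psi_symm_mem_rootSpace {γ : Module.Dual K ↥D.H0} {v : A} (hv : v ∈ D.rootSpace γ) :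
    D.psi.symm v ∈ D.rootSpace (D.twist 0 1 γ) := by
  simpa [← psi_mem_rootSpace_iff] using hv

lemma rootSpace_twist_eq_bot_iff (z₁ z₂ : ℤ) (γ : Module.Dual K ↥D.H0) :
    D.rootSpace (D.twist z₁ z₂ γ) = ⊥ ↔ D.rootSpace γ = ⊥ := by
  have h₁ (γ : Module.Dual K ↥D.H0) :
      D.rootSpace (D.twist 1 0 γ) = ⊥ ↔ D.rootSpace γ = ⊥ := by
    simp only [Submodule.eq_bot_iff, ← phi_mem_rootSpace_iff]
    rw [D.phi.surjective.forall (p := fun x => x ∈ D.rootSpace γ → x = 0)]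
    simp
  have h₂ (γ : Module.Dual K ↥D.H0) :
      D.rootSpace (D.twist 0 1 γ) = ⊥ ↔ D.rootSpace γ = ⊥ := by
    simp only [Submodule.eq_bot_iff, ← psi_mem_rootSpace_iff]
    rw [D.psi.surjective.forall (p := fun x => x ∈ D.rootSpace γ → x = 0)]
    simp
  have h₃ (γ : Module.Dual K ↥D.H0) :
      D.rootSpace (D.twist z₁ 0 γ) = ⊥ ↔ D.rootSpace γ = ⊥ := by
    induction z₁ with
    | zero => simp
    | succ n ih => rw [← ih, ← h₁ (D.twist n 0 γ), twist_twist]; simp [add_comm]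
    | pred n ih =>
      rw [← ih, ← h₁ (D.twist (-n - 1) 0 γ), twist_twist]; simp
  have h₄ (γ : Module.Dual K ↥D.H0) :
      D.rootSpace (D.twist 0 z₂ γ) = ⊥ ↔ D.rootSpace γ = ⊥ := by
    induction z₂ with
    | zero => simp
    | succ n ih => rw [← ih, ← h₂ (D.twist 0 n γ), twist_twist]; simp [add_comm]
    | pred n ih =>
      rw [← ih, ← h₂ (D.twist 0 (-n - 1) γ), twist_twist]; simp
  rw [← h₄ γ, ← h₃ (D.twist 0 z₂ γ), twist_twist]
  simp

/-! ### The grading -/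

lemma grade_sup : D.grade 0 ⊔ D.grade 1 = ⊤ := by
  refine top_unique ?_
  rw [← D.gradeInternal.submodule_iSup_eq_top]
  refine iSup_le fun i => ?_
  fin_cases i
  exacts [le_sup_left, le_sup_right]

lemma grade_disjoint : Disjoint (D.grade 0) (D.grade 1) :=
  D.gradeInternal.submodule_iSupIndep.pairwiseDisjoint (by decide)

lemma phi_mem_grade {i : ZMod 2} {x : A} (hx : x ∈ D.grade i) : D.phi x ∈ D.grade i := by
  rw [← D.phi_grade]; exact Submodule.mem_map_of_mem hx

lemma psi_mem_grade {i : ZMod 2} {x : A} (hx : x ∈ D.grade i) : D.psi x ∈ D.grade i := by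
  rw [← D.psi_grade]; exact Submodule.mem_map_of_mem hx

lemma phi_symm_mem_grade {i : ZMod 2} {x : A} (hx : x ∈ D.grade i) :
    D.phi.symm x ∈ D.grade i := by
  rw [← D.phi_grade] at hx
  obtain ⟨y, hy, rfl⟩ := hx
  simpa using hy

lemma psi_symm_mem_grade {i : ZMod 2} {x : A} (hx : x ∈ D.grade i) :
    D.psi.symm x ∈ D.grade i := by
  rw [← D.psi_grade] at hx
  obtain ⟨y, hy, rfl⟩ := hx
  simpa using hy

lemma exists_homogeneous_add (x : A) : ∃ x₀ ∈ D.grade 0, ∃ x₁ ∈ D.grade 1, x₀ + x₁ = x :=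
  Submodule.mem_sup.1 (D.grade_sup ▸ Submodule.mem_top)

lemma rootSpace_exists_homogeneous_add {γ : Module.Dual K ↥D.H0} {v : A}
    (hv : v ∈ D.rootSpace γ) :
    ∃ v₀ ∈ D.rootSpace γ ⊓ D.grade 0, ∃ v₁ ∈ D.rootSpace γ ⊓ D.grade 1, v₀ + v₁ = v := by
  obtain ⟨v₀, h₀, v₁, h₁, rfl⟩ := D.exists_homogeneous_add v
  have hmem {i : ZMod 2} {x : A} (hx : x ∈ D.grade i) (h : ↥D.H0) :
      D.br (h : A) (D.phi x) - γ h • D.phi (D.psi x) ∈ D.grade i := by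
    refine sub_mem ?_ (Submodule.smul_mem _ _ (D.phi_mem_grade (D.psi_mem_grade hx)))
    simpa using D.br_grade 0 i h h.2.2 _ (D.phi_mem_grade hx)
  have key : v₀ ∈ D.rootSpace γ := fun h => by
    rw [← sub_eq_zero]
    refine Submodule.disjoint_def.1 D.grade_disjoint _ (hmem h₀ h) ?_
    have hsum := hv h
    simp only [map_add, smul_add] at hsum
    have : D.br (h : A) (D.phi v₀) - γ h • D.phi (D.psi v₀)
        = -(D.br (h : A) (D.phi v₁) - γ h • D.phi (D.psi v₁)) := by
      rw [← sub_eq_zero] at hsum ⊢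
      rw [← hsum]
      abel
    rw [this]
    exact neg_mem (hmem h₁ h)
  exact ⟨v₀, ⟨key, h₀⟩, v₁, ⟨(Submodule.add_mem_iff_right _ key).1 hv, h₁⟩, rfl⟩

lemma rootSpace_le {γ : Module.Dual K ↥D.H0} {S : Submodule K A}
    (h : ∀ i, D.rootSpace γ ⊓ D.grade i ≤ S) : D.rootSpace γ ≤ S := fun v hv => by
  obtain ⟨v₀, h₀, v₁, h₁, rfl⟩ := D.rootSpace_exists_homogeneous_add hv
  exact add_mem (h 0 h₀) (h 1 h₁)

lemma map₂_rootSpace_le (B : A →ₗ[K] A →ₗ[K] A) {γ δ : Module.Dual K ↥D.H0} {S : Submodule K A}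
    (h : ∀ i j, ∀ x ∈ D.rootSpace γ ⊓ D.grade i, ∀ y ∈ D.rootSpace δ ⊓ D.grade j, B x y ∈ S) :
    Submodule.map₂ B (D.rootSpace γ) (D.rootSpace δ) ≤ S := by
  rw [Submodule.map₂_le]
  intro x hx y hy
  refine D.rootSpace_le (S := S.comap (B.flip y)) (fun i x hx => ?_) hx
  exact D.rootSpace_le (S := S.comap (B x)) (fun j y hy => h i j x hx y hy) hy

/-! ### Products of root spaces -/

lemma skew_H0 (h : ↥D.H0) (v : A) : D.br (D.psi v) (D.phi h) = -D.br (D.psi h) (D.phi v) := by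
  have hom {i : ZMod 2} {x : A} (hx : x ∈ D.grade i) :
      D.br (D.psi x) (D.phi h) = -D.br (D.psi h) (D.phi x) := by
    simpa using D.skew i 0 x hx h h.2.2
  obtain ⟨v₀, h₀, v₁, h₁, rfl⟩ := D.exists_homogeneous_add v
  simp only [map_add, LinearMap.add_apply, hom h₀, hom h₁, neg_add]

lemma mem_rootSpace_iff_br_phi {γ : Module.Dual K ↥D.H0} {v : A} :
    v ∈ D.rootSpace γ ↔
      ∀ h : ↥D.H0, D.br v (D.phi h) = -(D.twist 0 2 γ h) • D.phi v := by
  rw [← D.psi.apply_symm_apply v, psi_mem_rootSpace_iff]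
  refine D.psiH0.surjective.forall.trans (forall_congr' fun h => ?_)
  rw [D.skew_H0, neg_smul, neg_inj, coe_psiH0]
  rw [twist_apply_psiH0, one_add_one_eq_two]

lemma leibniz_H0 (x y : A) (h : ↥D.H0) :
    D.br (D.mu x y) (D.phi (D.psi h))
      = D.mu (D.phi x) (D.br y (D.phi h)) + D.mu (D.br x (D.psi h)) (D.phi y) := by
  have hom {i : ZMod 2} {y : A} (hy : y ∈ D.grade i) :
      D.br (D.mu x y) (D.phi (D.psi h))
        = D.mu (D.phi x) (D.br y (D.phi h)) + D.mu (D.br x (D.psi h)) (D.phi y) := by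
    simpa using D.leibniz i 0 x y hy h h.2.2
  obtain ⟨y₀, h₀, y₁, h₁, rfl⟩ := D.exists_homogeneous_add y
  simp only [map_add, LinearMap.add_apply, hom h₀, hom h₁]
  abel

lemma mu_mem_rootSpace {γ δ : Module.Dual K ↥D.H0} {x y : A} (hx : x ∈ D.rootSpace γ)
    (hy : y ∈ D.rootSpace δ) :
    D.mu x y ∈ D.rootSpace (D.twist (-1) 0 γ + D.twist 0 (-1) δ) := by
  rw [mem_rootSpace_iff_br_phi] at hx hy ⊢
  refine D.psiH0.surjective.forall.2 fun h => ?_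
  have hxh := hx ((D.phiH0 ^ (-1 : ℤ) * D.psiH0 ^ (1 : ℤ)) h)
  have e : (D.phi ((D.phiH0 ^ (-1 : ℤ) * D.psiH0 ^ (1 : ℤ)) h : ↥D.H0) : A) = D.psi h := by
    rw [← coe_phiH0, ← coe_psiH0, ← LinearEquiv.mul_apply, ← mul_assoc]
    simp
  rw [e] at hxh
  rw [coe_psiH0, D.leibniz_H0, hy, hxh, D.phi_mu]
  have e₁ : D.twist 0 2 γ ((D.phiH0 ^ (-1 : ℤ) * D.psiH0 ^ (1 : ℤ)) h) = D.twist (-1) 3 γ h := by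
    rw [← twist_apply D (-1) 1 (D.twist 0 2 γ), twist_twist]
    norm_num
  rw [e₁, twist_add, LinearMap.add_apply, twist_twist, twist_twist, twist_apply_psiH0,
    twist_apply_psiH0]
  norm_num
  module

lemma br_mem_rootSpace {γ δ : Module.Dual K ↥D.H0} {x y : A} (hx : x ∈ D.rootSpace γ)
    (hy : y ∈ D.rootSpace δ) :
    D.br x y ∈ D.rootSpace (D.twist (-1) 0 γ + D.twist 0 (-1) δ) := by
  refine D.map₂_rootSpace_le D.br (fun i j x hx y hy => ?_) (Submodule.apply_mem_map₂ _ hx hy)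
  obtain ⟨x, rfl⟩ := D.psi.surjective x
  obtain ⟨y, rfl⟩ := D.phi.surjective y
  obtain ⟨hx, hxi⟩ := hx
  obtain ⟨hy, hyj⟩ := hy
  replace hxi : x ∈ D.grade i := by simpa using D.psi_symm_mem_grade hxi
  replace hyj : y ∈ D.grade j := by simpa using D.phi_symm_mem_grade hyj
  rw [SetLike.mem_coe, psi_mem_rootSpace_iff] at hx
  rw [SetLike.mem_coe, phi_mem_rootSpace_iff] at hy
  rw [← D.phi.apply_symm_apply (D.br _ _), phi_mem_rootSpace_iff, mem_rootSpace]
  refine (D.psiH0.surjective.comp D.psiH0.surjective).forall.2 fun h => ?_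
  have hj := D.jacobi 0 i j h h.2.2 x hxi y hyj
  have hxh := hx (D.psiH0 h)
  have hyh := hy (D.psiH0 h)
  rw [coe_psiH0] at hxh hyh
  rw [D.skew_H0, hxh, hyh] at hj
  have hs := D.skew j i (D.psi y) (D.psi_mem_grade hyj) (D.psi x) (D.psi_mem_grade hxi)
  rw [mul_comm j.val] at hs
  have hsq : (-1 : K) ^ (i.val * j.val) * (-1 : K) ^ (i.val * j.val) = 1 := by
    rw [← mul_pow]; simp
  have hw : D.br (D.psi (D.psi h)) (D.br (D.psi x) (D.phi y))
      = (D.twist 0 1 γ (D.psiH0 h) + D.twist 1 0 δ (D.psiH0 h)) •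
        D.br (D.psi (D.psi x)) (D.phi (D.psi y)) := by
    simp only [map_neg, map_smul, hs, smul_smul, ZMod.val_zero, zero_mul, pow_zero, one_smul] at hj
    rw [mul_comm, mul_assoc, neg_mul, hsq] at hj
    rw [← sub_eq_zero, ← hj]
    module
  simp only [Function.comp_apply, coe_psiH0, LinearEquiv.apply_symm_apply, twist_add,
    LinearMap.add_apply, twist_twist, twist_apply_psiH0, D.phi_psi_comm] at hw ⊢
  rw [hw, D.psi_br]
  norm_num

/-! ### Connected roots -/

lemma chainSum_twist (z₁ z₂ : ℤ) (a : ℕ → Module.Dual K ↥D.H0) (i : ℕ) :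
    D.chainSum (fun t => D.twist z₁ z₂ (a t)) i = D.twist z₁ z₂ (D.chainSum a i) := by
  simp only [chainSum, twist_add, twist_sum, twist_twist, add_comm]

lemma chainSum_congr {a b : ℕ → Module.Dual K ↥D.H0} {i : ℕ}
    (h : ∀ t, 1 ≤ t → t ≤ i + 1 → a t = b t) : D.chainSum a i = D.chainSum b i := by
  rw [chainSum, chainSum, h 1 le_rfl (by omega)]
  congr 1
  refine Finset.sum_congr rfl fun t ht => ?_
  rw [Finset.mem_Icc] at ht
  rw [h t (by omega) ht.2]

lemma chainSum_succ (a : ℕ → Module.Dual K ↥D.H0) (i : ℕ) :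
    D.chainSum a (i + 1) = D.twist (-1) 0 (D.chainSum a i) + D.twist 0 (-1) (a (i + 2)) := by
  rw [chainSum, Finset.sum_Icc_succ_top (by omega), ← add_assoc, chainSum]
  simp only [twist_add, twist_sum, twist_twist]
  congr 2
  · push_cast; ring_nf
  · refine Finset.sum_congr rfl fun t _ => ?_
    push_cast; ring_nf
  · push_cast; ring_nf

lemma chainSum_zero (a : ℕ → Module.Dual K ↥D.H0) : D.chainSum a 0 = a 1 := by
  simp [chainSum]

lemma twist_mem_roots {γ : Module.Dual K ↥D.H0} (h : γ ∈ D.roots) (z₁ z₂ : ℤ) :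
    D.twist z₁ z₂ γ ∈ D.roots := by
  refine ⟨fun h0 => h.1 ?_, fun h0 => h.2 ?_⟩
  · rwa [twist_eq_iff, twist_zero] at h0
  · rwa [rootSpace_twist_eq_bot_iff] at h0

lemma neg_mem_pm_roots {γ : Module.Dual K ↥D.H0} (h : γ ∈ D.pm D.roots) :
    -γ ∈ D.pm D.roots := by
  rcases h with h | ⟨δ, h, rfl⟩
  · exact Or.inr ⟨γ, h, rfl⟩
  · rw [neg_neg]; exact Or.inl h

lemma twist_mem_pm_roots {γ : Module.Dual K ↥D.H0} (h : γ ∈ D.pm D.roots) (z₁ z₂ : ℤ) :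
    D.twist z₁ z₂ γ ∈ D.pm D.roots := by
  rcases h with h | ⟨δ, h, rfl⟩
  · exact Or.inl (D.twist_mem_roots h z₁ z₂)
  · exact D.neg_mem_pm_roots (Or.inl (D.twist_mem_roots h z₁ z₂))

lemma IsConnectionIn.twist {α β : Module.Dual K ↥D.H0} {k : ℕ} {a : ℕ → Module.Dual K ↥D.H0}
    (h : D.IsConnectionIn D.roots α β k a) (z₁ z₂ : ℤ) :
    ∃ b, D.IsConnectionIn D.roots α (D.twist z₁ z₂ β) k b := by
  obtain ⟨hk, ha, ⟨n, r, h₁⟩, hs, m, s, hβ⟩ := h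
  refine ⟨fun t => D.twist (-(z₁.natAbs : ℤ)) (-(z₂.natAbs : ℤ)) (a t), hk,
    fun t h1 h2 => D.twist_mem_pm_roots (ha t h1 h2) _ _,
    ⟨n + z₁.natAbs, r + z₂.natAbs, ?_⟩, fun i h1 h2 => ?_,
    ⟨(m + z₁.natAbs + z₁).toNat, (s + z₂.natAbs + z₂).toNat, ?_⟩⟩
  · simp only [h₁, twist_twist]
    push_cast
    ring_nf
  · rw [chainSum_twist]
    exact D.twist_mem_pm_roots (hs i h1 h2) _ _
  · have e₁ : -((m + z₁.natAbs + z₁).toNat : ℤ) + z₁ = -(z₁.natAbs : ℤ) + -(m : ℤ) := by omega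
    have e₂ : -((s + z₂.natAbs + z₂).toNat : ℤ) + z₂ = -(z₂.natAbs : ℤ) + -(s : ℤ) := by omega
    rw [chainSum_twist, twist_twist, e₁, e₂]
    exact hβ.imp (fun h => by rw [h, twist_twist]) (fun h => by rw [h, twist_neg, twist_twist])

lemma Connected.twist {α β : Module.Dual K ↥D.H0} (h : D.Connected α β) (z₁ z₂ : ℤ) :
    D.Connected α (D.twist z₁ z₂ β) := by
  rcases h with ⟨w₁, w₂, ε, hε, rfl⟩ | ⟨k, a, h⟩
  · refine Or.inl ⟨z₁ + w₁, z₂ + w₂, ε, hε, ?_⟩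
    rw [← twist_twist]
    exact LinearMap.smul_comp _ _ _
  · obtain ⟨b, hb⟩ := h.twist D z₁ z₂
    exact Or.inr ⟨k, b, hb⟩

lemma Connected.neg {α β : Module.Dual K ↥D.H0} (h : D.Connected α β) : D.Connected α (-β) := by
  rcases h with ⟨w₁, w₂, ε, hε, rfl⟩ | ⟨k, a, hk, ha, h₁, hs, m, s, hβ⟩
  · exact Or.inl ⟨w₁, w₂, -ε, hε.symm.imp (by rintro rfl; simp) (by rintro rfl; rfl),
      (neg_smul _ _).symm⟩
  · refine Or.inr ⟨k, a, hk, ha, h₁, hs, m, s, ?_⟩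
    rw [twist_neg, neg_neg]
    exact hβ.symm

lemma neg_one_smul_dual (γ : Module.Dual K ↥D.H0) : (-1 : K) • γ = -γ := by
  ext h
  simp

/-- A connection from `α` to `β` can be prolonged by any `δ ∈ ±Λ`. -/
lemma Connected.add {α β δ : Module.Dual K ↥D.H0} (h : D.Connected α β)
    (hβ : β ∈ D.pm D.roots) (hδ : δ ∈ D.pm D.roots) :
    D.Connected α (D.twist (-1) 0 β + D.twist 0 (-1) δ) := by
  -- up to a twist and a sign, `β` is the last partial sum of a chain starting at `α`
  have key : ∃ k : ℕ, ∃ a : ℕ → Module.Dual K ↥D.H0, 1 ≤ k ∧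
      (∀ t, 1 ≤ t → t ≤ k → a t ∈ D.pm D.roots) ∧
      (∃ n r : ℕ, a 1 = D.twist (-(n : ℤ)) (-(r : ℤ)) α) ∧
      (∀ i, 1 ≤ i → i ≤ k - 2 → D.chainSum a i ∈ D.pm D.roots) ∧
      (∃ m s : ℕ, D.chainSum a (k - 1) = D.twist (-(m : ℤ)) (-(s : ℤ)) β
        ∨ D.chainSum a (k - 1) = -(D.twist (-(m : ℤ)) (-(s : ℤ)) β)) := by
    rcases h with ⟨w₁, w₂, ε, hε, rfl⟩ | ⟨k, a, hk, h⟩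
    · have hα : D.twist (-(w₁.natAbs : ℤ)) (-(w₂.natAbs : ℤ)) (D.twist w₁ w₂ α)
          ∈ D.pm D.roots := by
        refine D.twist_mem_pm_roots ?_ _ _
        rcases hε with rfl | rfl
        · simpa using hβ
        · rw [neg_one_smul_dual] at hβ
          exact neg_neg (D.twist w₁ w₂ α) ▸ D.neg_mem_pm_roots hβ
      refine ⟨1, fun _ => D.twist (-(w₁.natAbs : ℤ)) (-(w₂.natAbs : ℤ)) (D.twist w₁ w₂ α),
        le_rfl, fun _ _ _ => hα, ⟨(w₁.natAbs - w₁).toNat, (w₂.natAbs - w₂).toNat, ?_⟩,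
        fun i h1 h2 => by omega, w₁.natAbs, w₂.natAbs, ?_⟩
      · rw [twist_twist]
        rw [show -((w₁.natAbs - w₁).toNat : ℤ) = -(w₁.natAbs : ℤ) + w₁ by omega,
          show -((w₂.natAbs - w₂).toNat : ℤ) = -(w₂.natAbs : ℤ) + w₂ by omega]
      · rw [chainSum_zero]
        rcases hε with rfl | rfl
        · left; simp
        · right; rw [neg_one_smul_dual, twist_neg, neg_neg]
    · exact ⟨k, a, by omega, h⟩
  obtain ⟨k, a, hk, ha, ⟨n, r, h₁⟩, hs, m, s, hsum⟩ := key
  have aux : ∀ δ' ∈ D.pm D.roots, ∃ b : ℕ → Module.Dual K ↥D.H0,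
      (∀ t, 1 ≤ t → t ≤ k → b t = a t) ∧ (∀ t, 1 ≤ t → t ≤ k + 1 → b t ∈ D.pm D.roots) ∧
      D.chainSum b k = D.twist (-1) 0 (D.chainSum a (k - 1)) + D.twist 0 (-1) δ' := by
    intro δ' hδ'
    have hb : ∀ t, 1 ≤ t → t ≤ k → Function.update a (k + 1) δ' t = a t :=
      fun t _ h2 => Function.update_of_ne (by omega) _ _
    refine ⟨Function.update a (k + 1) δ', hb, fun t h1 h2 => ?_, ?_⟩
    · rcases Nat.lt_or_ge k t with h | h
      · obtain rfl : t = k + 1 := by omega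
        rwa [Function.update_self]
      · rw [hb t h1 h]; exact ha t h1 h
    · obtain ⟨l, rfl⟩ : ∃ l, k = l + 1 := ⟨k - 1, by omega⟩
      rw [chainSum_succ, Function.update_self, D.chainSum_congr hb, Nat.add_sub_cancel]
  have fin : ∀ b : ℕ → Module.Dual K ↥D.H0, (∀ t, 1 ≤ t → t ≤ k → b t = a t) →
      (∀ t, 1 ≤ t → t ≤ k + 1 → b t ∈ D.pm D.roots) →
      (D.chainSum b k = D.twist (-(m : ℤ)) (-(s : ℤ)) (D.twist (-1) 0 β + D.twist 0 (-1) δ) ∨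
        D.chainSum b k
          = -D.twist (-(m : ℤ)) (-(s : ℤ)) (D.twist (-1) 0 β + D.twist 0 (-1) δ)) →
      D.Connected α (D.twist (-1) 0 β + D.twist 0 (-1) δ) := by
    intro b hba hb hbk
    refine Or.inr ⟨k + 1, b, by omega, hb, ⟨n, r, by rw [hba 1 le_rfl hk, h₁]⟩,
      fun i h1 h2 => ?_, m, s, hbk⟩
    rw [D.chainSum_congr fun t h1' h2' => hba t h1' (by omega)]
    rcases Nat.lt_or_ge (k - 2) i with h | h
    · obtain rfl : i = k - 1 := by omega
      rcases hsum with h | h <;> rw [h]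
      · exact D.twist_mem_pm_roots hβ _ _
      · exact D.neg_mem_pm_roots (D.twist_mem_pm_roots hβ _ _)
    · exact hs i h1 h
  rcases hsum with h | h
  · obtain ⟨b, h1, h2, h3⟩ := aux _ (D.twist_mem_pm_roots hδ (-(m : ℤ)) (-(s : ℤ)))
    refine fin b h1 h2 (Or.inl ?_)
    rw [h3, h, twist_add]
    simp only [twist_twist, add_comm]
  · obtain ⟨b, h1, h2, h3⟩ :=
      aux _ (D.neg_mem_pm_roots (D.twist_mem_pm_roots hδ (-(m : ℤ)) (-(s : ℤ))))
    refine fin b h1 h2 (Or.inr ?_)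
    rw [h3, h, twist_add]
    simp only [twist_neg, twist_twist, add_comm, neg_add]

/-! ### Vectors in the root spaces of a connectedness class -/

/-- `v` lies in a single space `A_γ`. -/
def IsRootVector (v : A) : Prop := ∃ γ, v ∈ D.rootSpace γ

/-- `v` lies in `A_β` for some `β ∈ ±Λ` connected to `α`. -/
def IsClassVector (α : Module.Dual K ↥D.H0) (v : A) : Prop :=
  ∃ β ∈ D.pm D.roots, D.Connected α β ∧ v ∈ D.rootSpace β

variable {D}

lemma IsRootVector.br {v w : A} (hv : D.IsRootVector v) (hw : D.IsRootVector w) :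
    D.IsRootVector (D.br v w) :=
  let ⟨_, hγ⟩ := hv
  let ⟨_, hδ⟩ := hw
  ⟨_, D.br_mem_rootSpace hγ hδ⟩

lemma IsRootVector.mu {v w : A} (hv : D.IsRootVector v) (hw : D.IsRootVector w) :
    D.IsRootVector (D.mu v w) :=
  let ⟨_, hγ⟩ := hv
  let ⟨_, hδ⟩ := hw
  ⟨_, D.mu_mem_rootSpace hγ hδ⟩

lemma IsRootVector.phi {v : A} (hv : D.IsRootVector v) : D.IsRootVector (D.phi v) :=
  let ⟨_, h⟩ := hv
  ⟨_, D.phi_mem_rootSpace h⟩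

lemma IsRootVector.psi {v : A} (hv : D.IsRootVector v) : D.IsRootVector (D.psi v) :=
  let ⟨_, h⟩ := hv
  ⟨_, D.psi_mem_rootSpace h⟩

lemma IsRootVector.phi_symm {v : A} (hv : D.IsRootVector v) : D.IsRootVector (D.phi.symm v) :=
  let ⟨_, h⟩ := hv
  ⟨_, D.phi_symm_mem_rootSpace h⟩

lemma IsRootVector.psi_symm {v : A} (hv : D.IsRootVector v) : D.IsRootVector (D.psi.symm v) :=
  let ⟨_, h⟩ := hv
  ⟨_, D.psi_symm_mem_rootSpace h⟩

variable {α : Module.Dual K ↥D.H0}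

lemma IsClassVector.isRootVector {v : A} (hv : D.IsClassVector α v) : D.IsRootVector v :=
  let ⟨β, _, _, h⟩ := hv
  ⟨β, h⟩

lemma IsClassVector.phi {v : A} (hv : D.IsClassVector α v) : D.IsClassVector α (D.phi v) :=
  let ⟨_, hβ, hc, h⟩ := hv
  ⟨_, D.twist_mem_pm_roots hβ _ _, hc.twist D _ _, D.phi_mem_rootSpace h⟩

lemma IsClassVector.psi {v : A} (hv : D.IsClassVector α v) : D.IsClassVector α (D.psi v) :=
  let ⟨_, hβ, hc, h⟩ := hv
  ⟨_, D.twist_mem_pm_roots hβ _ _, hc.twist D _ _, D.psi_mem_rootSpace h⟩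

lemma IsClassVector.phi_symm {v : A} (hv : D.IsClassVector α v) :
    D.IsClassVector α (D.phi.symm v) :=
  let ⟨_, hβ, hc, h⟩ := hv
  ⟨_, D.twist_mem_pm_roots hβ _ _, hc.twist D _ _, D.phi_symm_mem_rootSpace h⟩

lemma IsClassVector.psi_symm {v : A} (hv : D.IsClassVector α v) :
    D.IsClassVector α (D.psi.symm v) :=
  let ⟨_, hβ, hc, h⟩ := hv
  ⟨_, D.twist_mem_pm_roots hβ _ _, hc.twist D _ _, D.psi_symm_mem_rootSpace h⟩

variable (D)

lemma eq_zero_or_mem_roots {γ : Module.Dual K ↥D.H0} {v : A} (hv : v ∈ D.rootSpace γ)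
    (h0 : v ≠ 0) : γ = 0 ∨ γ ∈ D.roots := by
  refine or_iff_not_imp_left.2 fun hγ => ⟨hγ, fun h => h0 ?_⟩
  rwa [h, Submodule.mem_bot] at hv

lemma zero_notMem_pm_roots : (0 : Module.Dual K ↥D.H0) ∉ D.pm D.roots := by
  rintro (h | ⟨δ, h, h0⟩)
  · exact h.1 rfl
  · exact h.1 (neg_eq_zero.1 h0)

lemma ne_zero_of_mem_pm_roots {γ : Module.Dual K ↥D.H0} (h : γ ∈ D.pm D.roots) : γ ≠ 0 := by
  rintro rfl
  exact D.zero_notMem_pm_roots h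

lemma rootSpace_le_Iclass {β : Module.Dual K ↥D.H0} (hβ : β ≠ 0) (hc : D.Connected α β) :
    D.rootSpace β ≤ D.Iclass α := by
  by_cases h : D.rootSpace β = ⊥
  · rw [h]; exact bot_le
  · exact (le_iSup₂_of_le β ⟨⟨hβ, h⟩, hc⟩ le_rfl : _ ≤ D.VS α).trans le_sup_right

lemma IsClassVector.mem_Iclass {v : A} (hv : D.IsClassVector α v) : v ∈ D.Iclass α :=
  let ⟨_, hβ, hc, h⟩ := hv
  D.rootSpace_le_Iclass (D.ne_zero_of_mem_pm_roots hβ) hc h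

lemma mul_mem_Iclass_of_twist {β : Module.Dual K ↥D.H0} (hβ : β ≠ 0) (hc : D.Connected α β)
    {x y : A} (hx : x ∈ D.rootSpace (D.twist 0 (-1) β))
    (hy : y ∈ D.rootSpace (-(D.twist (-1) 0 β))) :
    D.br x y ∈ D.Iclass α ∧ D.mu x y ∈ D.Iclass α := by
  by_cases h : D.rootSpace β = ⊥
  · rw [← D.rootSpace_twist_eq_bot_iff 0 (-1)] at h
    rw [h, Submodule.mem_bot] at hx
    simp [hx]
  · have hle := (le_iSup₂_of_le β ⟨⟨hβ, h⟩, hc⟩ le_rfl : _ ≤ D.IH α).trans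
      (le_sup_left : _ ≤ D.Iclass α)
    exact ⟨hle (Submodule.mem_sup_left (Submodule.apply_mem_map₂ _ hx hy)),
      hle (Submodule.mem_sup_right (Submodule.apply_mem_map₂ _ hx hy))⟩

/-- A vector of a nonzero product root space `A_{β∘φ⁻¹ + δ∘ψ⁻¹}` lies in `I_{[α]}` as soon as
`β` is connected to `α`. -/
lemma mem_Iclass_of_mem_rootSpace_add {β δ : Module.Dual K ↥D.H0} (hβ : β ∈ D.pm D.roots)
    (hc : D.Connected α β) (hδ : δ = 0 ∨ δ ∈ D.roots) {w : A}
    (hw : w ∈ D.rootSpace (D.twist (-1) 0 β + D.twist 0 (-1) δ))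
    (h0 : D.twist (-1) 0 β + D.twist 0 (-1) δ ≠ 0) : w ∈ D.Iclass α := by
  refine D.rootSpace_le_Iclass h0 ?_ hw
  rcases hδ with rfl | hδ
  · rw [twist_zero, add_zero]; exact hc.twist D _ _
  · exact hc.add D hβ (Or.inl hδ)

lemma IsClassVector.mul_mem_Iclass {x a : A} (hx : D.IsClassVector α x)
    (ha : D.IsRootVector a) : D.br x a ∈ D.Iclass α ∧ D.mu x a ∈ D.Iclass α := by
  obtain ⟨β, hβ, hc, hx⟩ := hx
  obtain ⟨δ, ha⟩ := ha
  by_cases ha0 : a = 0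
  · simp [ha0]
  by_cases h0 : D.twist (-1) 0 β + D.twist 0 (-1) δ = 0
  · have hδ : δ = -D.twist (-1) 1 β := by
      rw [add_comm, add_eq_zero_iff_eq_neg, twist_eq_iff, twist_neg, twist_twist] at h0
      simpa using h0
    refine D.mul_mem_Iclass_of_twist (β := D.twist 0 1 β)
      (D.ne_zero_of_mem_pm_roots (D.twist_mem_pm_roots hβ _ _)) (hc.twist D _ _) ?_ ?_
    · simpa [twist_twist] using hx
    · simpa [twist_twist, hδ] using ha
  · have hδ := D.eq_zero_or_mem_roots ha ha0
    exact ⟨D.mem_Iclass_of_mem_rootSpace_add hβ hc hδ (D.br_mem_rootSpace hx ha) h0,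
      D.mem_Iclass_of_mem_rootSpace_add hβ hc hδ (D.mu_mem_rootSpace hx ha) h0⟩

lemma IsRootVector.mul_mem_Iclass {a x : A} (ha : D.IsRootVector a)
    (hx : D.IsClassVector α x) : D.br a x ∈ D.Iclass α ∧ D.mu a x ∈ D.Iclass α := by
  obtain ⟨β, hβ, hc, hx⟩ := hx
  obtain ⟨δ, ha⟩ := ha
  by_cases ha0 : a = 0
  · simp [ha0]
  by_cases h0 : D.twist (-1) 0 δ + D.twist 0 (-1) β = 0
  · have hδ : δ = -D.twist 1 (-1) β := by
      rw [add_eq_zero_iff_eq_neg, twist_eq_iff, twist_neg, twist_twist] at h0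
      simpa using h0
    refine D.mul_mem_Iclass_of_twist (β := -D.twist 1 0 β)
      (neg_ne_zero.2 (D.ne_zero_of_mem_pm_roots (D.twist_mem_pm_roots hβ _ _)))
      ((hc.twist D _ _).neg D) ?_ ?_
    · simpa [twist_neg, twist_twist, hδ] using ha
    · simpa [twist_neg, twist_twist] using hx
  · have hδ : D.twist (-1) 1 δ = 0 ∨ D.twist (-1) 1 δ ∈ D.roots :=
      (D.eq_zero_or_mem_roots ha ha0).imp (by rintro rfl; rfl) (D.twist_mem_roots · _ _)
    have e : D.twist (-1) 0 δ + D.twist 0 (-1) β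
        = D.twist (-1) 0 (D.twist 1 (-1) β) + D.twist 0 (-1) (D.twist (-1) 1 δ) := by
      simp [twist_twist, add_comm]
    have hbr := D.br_mem_rootSpace ha hx
    have hmu := D.mu_mem_rootSpace ha hx
    rw [e] at h0 hbr hmu
    have hβ' := D.twist_mem_pm_roots hβ 1 (-1)
    have hc' := hc.twist D 1 (-1)
    exact ⟨D.mem_Iclass_of_mem_rootSpace_add hβ' hc' hδ hbr h0,
      D.mem_Iclass_of_mem_rootSpace_add hβ' hc' hδ hmu h0⟩

/-! ### Products with the generators of `I_{H,[α]}` -/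

lemma neg_one_pow_smul_mem_iff (n : ℕ) (S : Submodule K A) (v : A) :
    ((-1 : K) ^ n) • v ∈ S ↔ v ∈ S :=
  S.smul_mem_iff (pow_ne_zero _ (neg_ne_zero.2 one_ne_zero))

lemma br_swap_mem_iff {i j : ZMod 2} {x y : A} (hx : x ∈ D.grade i) (hy : y ∈ D.grade j)
    (S : Submodule K A) :
    D.br x y ∈ S ↔ D.br (D.psi (D.phi.symm y)) (D.phi (D.psi.symm x)) ∈ S := by
  have h := D.skew i j _ (D.psi_symm_mem_grade hx) _ (D.phi_symm_mem_grade hy)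
  simp only [LinearEquiv.apply_symm_apply] at h
  rw [h, neg_smul, neg_mem_iff, neg_one_pow_smul_mem_iff]

section

variable {i j k : ZMod 2} {x y a : A}

lemma br_br_mem_Iclass (hx : D.IsClassVector α x) (hxi : x ∈ D.grade i)
    (hy : D.IsClassVector α y) (hyj : y ∈ D.grade j)
    (ha : D.IsRootVector a) (hak : a ∈ D.grade k) : D.br (D.br x y) a ∈ D.Iclass α := by
  have aux {x y a : A} (hx : D.IsClassVector α x) (hxi : x ∈ D.grade i)
      (hy : D.IsClassVector α y) (hyj : y ∈ D.grade j) (ha : D.IsRootVector a)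
      (hak : a ∈ D.grade k) :
      D.br (D.psi (D.psi a)) (D.br (D.psi x) (D.phi y)) ∈ D.Iclass α := by
    have hj := D.jacobi i j k x hxi y hyj a hak
    rw [← neg_one_pow_smul_mem_iff (j.val * k.val), ← neg_mem_iff, ← eq_neg_of_add_eq_zero_left hj]
    refine add_mem ?_ ?_ <;> rw [neg_one_pow_smul_mem_iff]
    · exact (hx.psi.psi.mul_mem_Iclass D (hy.isRootVector.psi.br ha.phi)).1
    · exact (hy.psi.psi.mul_mem_Iclass D (ha.psi.br hx.isRootVector.phi)).1
  rw [D.br_swap_mem_iff (D.br_grade i j x hxi y hyj) hak]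
  have h := aux hx.phi.psi_symm.psi_symm (D.psi_symm_mem_grade (D.psi_symm_mem_grade
    (D.phi_mem_grade hxi))) hy.psi_symm (D.psi_symm_mem_grade hyj) ha.phi_symm.psi_symm
    (D.psi_symm_mem_grade (D.phi_symm_mem_grade hak))
  have e : D.phi (D.psi.symm (D.br x y))
      = D.br (D.phi (D.psi.symm x)) (D.phi (D.psi.symm y)) := by
    rw [← D.phi_br, D.phi.injective.eq_iff, LinearEquiv.symm_apply_eq, D.psi_br]
    simp
  have e' : D.psi.symm (D.phi x) = D.phi (D.psi.symm x) := by
    rw [LinearEquiv.symm_apply_eq, ← D.phi_psi_comm]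
    simp
  simpa [e, e'] using h

lemma mu_mu_mem_Iclass (hx : D.IsClassVector α x) (hy : D.IsClassVector α y)
    (ha : D.IsRootVector a) : D.mu (D.mu x y) a ∈ D.Iclass α := by
  have h := D.assoc x y (D.psi.symm a)
  rw [LinearEquiv.apply_symm_apply] at h
  rw [← h]
  exact (hx.phi.mul_mem_Iclass D (hy.isRootVector.mu ha.psi_symm)).2

lemma mu_mu_mem_Iclass' (hx : D.IsClassVector α x) (hy : D.IsClassVector α y)
    (ha : D.IsRootVector a) : D.mu a (D.mu x y) ∈ D.Iclass α := by
  have h := D.assoc (D.phi.symm a) x y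
  rw [LinearEquiv.apply_symm_apply] at h
  rw [h]
  exact ((ha.phi_symm.mu hx.isRootVector).mul_mem_Iclass D hy.psi).2

lemma br_mu_mem_Iclass (hx : D.IsClassVector α x)
    (hy : D.IsClassVector α y) (hyj : y ∈ D.grade j)
    (ha : D.IsRootVector a) (hak : a ∈ D.grade k) : D.br (D.mu x y) a ∈ D.Iclass α := by
  have h := D.leibniz j k x y hyj _ (D.psi_symm_mem_grade (D.phi_symm_mem_grade hak))
  simp only [LinearEquiv.apply_symm_apply] at h
  rw [h]
  refine add_mem ?_ ((neg_one_pow_smul_mem_iff _ _ _).2 ?_)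
  · exact (hx.phi.mul_mem_Iclass D (hy.isRootVector.br ha.phi_symm.psi_symm.phi)).2
  · exact ((hx.isRootVector.br ha.phi_symm).mul_mem_Iclass D hy.phi).2

lemma mu_br_mem_Iclass (hx : D.IsClassVector α x)
    (hy : D.IsClassVector α y) (hyj : y ∈ D.grade j)
    (ha : D.IsRootVector a) (hak : a ∈ D.grade k) : D.mu (D.br x y) a ∈ D.Iclass α := by
  have h := D.leibniz k j x _ (D.phi_symm_mem_grade hak) _ (D.psi_symm_mem_grade hyj)
  simp only [LinearEquiv.apply_symm_apply] at h
  rw [← neg_one_pow_smul_mem_iff (k.val * j.val), ← sub_eq_of_eq_add' h]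
  refine sub_mem ?_ ?_
  · exact ((hx.isRootVector.mu ha.phi_symm).mul_mem_Iclass D hy.phi).1
  · exact (hx.phi.mul_mem_Iclass D (ha.phi_symm.br hy.isRootVector.psi_symm.phi)).2

lemma mu_br_mem_Iclass' (hx : D.IsClassVector α x) (hxi : x ∈ D.grade i)
    (hy : D.IsClassVector α y) (hyj : y ∈ D.grade j)
    (ha : D.IsRootVector a) : D.mu a (D.br x y) ∈ D.Iclass α := by
  have h := D.leibniz i j (D.phi.symm a) x hxi _ (D.phi_symm_mem_grade hyj)
  simp only [LinearEquiv.apply_symm_apply] at h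
  rw [← sub_eq_of_eq_add h]
  refine sub_mem ?_ ((neg_one_pow_smul_mem_iff _ _ _).2 ?_)
  · exact ((ha.phi_symm.mu hx.isRootVector).mul_mem_Iclass D hy.phi_symm.psi.phi).1
  · exact ((ha.phi_symm.br hy.isRootVector.phi_symm.psi).mul_mem_Iclass D hx.phi).2

end

/-! ### Induction on the generators -/

lemma Iclass_le {S : Submodule K A}
    (h₁ : ∀ i, ∀ x ∈ D.grade i, D.IsClassVector α x → x ∈ S)
    (h₂ : ∀ i j, ∀ x ∈ D.grade i, ∀ y ∈ D.grade j, D.IsClassVector α x → D.IsClassVector α y →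
      D.br x y ∈ S ∧ D.mu x y ∈ S) :
    D.Iclass α ≤ S := by
  refine sup_le (iSup₂_le fun β hβ => ?_) (iSup₂_le fun β hβ => ?_)
  · have hpm : β ∈ D.pm D.roots := Or.inl hβ.1
    have key {i j : ZMod 2} {x y : A}
        (hx : x ∈ D.rootSpace (D.twist 0 (-1) β) ⊓ D.grade i)
        (hy : y ∈ D.rootSpace (-(D.twist (-1) 0 β)) ⊓ D.grade j) :=
      h₂ i j x hx.2 y hy.2 ⟨_, D.twist_mem_pm_roots hpm _ _, hβ.2.twist D _ _, hx.1⟩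
        ⟨_, D.neg_mem_pm_roots (D.twist_mem_pm_roots hpm _ _), (hβ.2.twist D _ _).neg D, hy.1⟩
    exact sup_le (D.map₂_rootSpace_le _ fun i j x hx y hy => (key hx hy).1)
      (D.map₂_rootSpace_le _ fun i j x hx y hy => (key hx hy).2)
  · exact D.rootSpace_le fun i x hx => h₁ i x hx.2 ⟨β, Or.inl hβ.1, hβ.2, hx.1⟩

lemma H_le_rootSpace_zero : D.H ≤ D.rootSpace 0 := fun v hv h => by
  rw [LinearMap.zero_apply, zero_smul]
  refine D.H_abelian _ h.2.1 _ ?_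
  rw [← D.phi_H]
  exact Submodule.mem_map_of_mem hv

lemma IsSplit.top_le (hsplit : D.IsSplit) {S : Submodule K A}
    (h : ∀ i, ∀ a ∈ D.grade i, D.IsRootVector a → a ∈ S) : ⊤ ≤ S := by
  have hγ (γ : Module.Dual K ↥D.H0) : D.rootSpace γ ≤ S :=
    D.rootSpace_le fun i a ha => h i a ha.2 ⟨γ, ha.1⟩
  let := Classical.decEq (Option ↥D.roots)
  rw [← DirectSum.IsInternal.submodule_iSup_eq_top hsplit]
  refine iSup_le fun o => ?_
  cases o with
  | none => exact D.H_le_rootSpace_zero.trans (hγ 0)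
  | some γ => exact hγ γ

lemma Iclass_graded :
    D.Iclass α = (D.Iclass α ⊓ D.grade 0) ⊔ (D.Iclass α ⊓ D.grade 1) := by
  refine le_antisymm ?_ (sup_le inf_le_left inf_le_left)
  have hom (i : ZMod 2) : D.Iclass α ⊓ D.grade i
      ≤ (D.Iclass α ⊓ D.grade 0) ⊔ (D.Iclass α ⊓ D.grade 1) := by
    fin_cases i
    exacts [le_sup_left, le_sup_right]
  refine D.Iclass_le (fun i x hxi hx => hom i ⟨hx.mem_Iclass D, hxi⟩)
    fun i j x hxi y hyj hx hy => ?_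
  have h := hx.mul_mem_Iclass D hy.isRootVector
  exact ⟨hom (i + j) ⟨h.1, D.br_grade i j x hxi y hyj⟩,
    hom (i + j) ⟨h.2, D.mu_grade i j x hxi y hyj⟩⟩

lemma map_phi_Iclass : (D.Iclass α).map (D.phi : A →ₗ[K] A) = D.Iclass α := by
  refine le_antisymm (Submodule.map_le_iff_le_comap.2 ?_) ?_
  · refine D.Iclass_le (fun i x _ hx => hx.phi.mem_Iclass D) fun i j x _ y _ hx hy => ?_
    simpa [D.phi_br, D.phi_mu] using hx.phi.mul_mem_Iclass D hy.isRootVector.phi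
  · refine D.Iclass_le (fun i x _ hx => ⟨_, hx.phi_symm.mem_Iclass D, by simp⟩)
      fun i j x _ y _ hx hy => ?_
    have h := hx.phi_symm.mul_mem_Iclass D hy.isRootVector.phi_symm
    exact ⟨⟨_, h.1, by simp [D.phi_br]⟩, ⟨_, h.2, by simp [D.phi_mu]⟩⟩

lemma map_psi_Iclass : (D.Iclass α).map (D.psi : A →ₗ[K] A) = D.Iclass α := by
  refine le_antisymm (Submodule.map_le_iff_le_comap.2 ?_) ?_
  · refine D.Iclass_le (fun i x _ hx => hx.psi.mem_Iclass D) fun i j x _ y _ hx hy => ?_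
    simpa [D.psi_br, D.psi_mu] using hx.psi.mul_mem_Iclass D hy.isRootVector.psi
  · refine D.Iclass_le (fun i x _ hx => ⟨_, hx.psi_symm.mem_Iclass D, by simp⟩)
      fun i j x _ y _ hx hy => ?_
    have h := hx.psi_symm.mul_mem_Iclass D hy.isRootVector.psi_symm
    exact ⟨⟨_, h.1, by simp [D.psi_br]⟩, ⟨_, h.2, by simp [D.psi_mu]⟩⟩

lemma Iclass_mul_le (hsplit : D.IsSplit) :
    Submodule.map₂ D.br (D.Iclass α) ⊤ ≤ D.Iclass α ∧
    Submodule.map₂ D.mu (D.Iclass α) ⊤ ≤ D.Iclass α ∧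
    Submodule.map₂ D.mu ⊤ (D.Iclass α) ≤ D.Iclass α := by
  refine ⟨Submodule.map₂_le.2 fun m hm n _ => ?_, Submodule.map₂_le.2 fun m hm n _ => ?_,
    Submodule.map₂_le.2 fun n _ m hm => ?_⟩
  · refine hsplit.top_le D (S := (D.Iclass α).comap (D.br m)) (fun k a hak ha => ?_)
      (Submodule.mem_top (x := n))
    refine D.Iclass_le (S := (D.Iclass α).comap (D.br.flip a))
      (fun i x _ hx => (hx.mul_mem_Iclass D ha).1) (fun i j x hxi y hyj hx hy => ⟨?_, ?_⟩) hm
    · exact D.br_br_mem_Iclass hx hxi hy hyj ha hak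
    · exact D.br_mu_mem_Iclass hx hy hyj ha hak
  · refine hsplit.top_le D (S := (D.Iclass α).comap (D.mu m)) (fun k a hak ha => ?_)
      (Submodule.mem_top (x := n))
    refine D.Iclass_le (S := (D.Iclass α).comap (D.mu.flip a))
      (fun i x _ hx => (hx.mul_mem_Iclass D ha).2) (fun i j x hxi y hyj hx hy => ⟨?_, ?_⟩) hm
    · exact D.mu_br_mem_Iclass hx hy hyj ha hak
    · exact D.mu_mu_mem_Iclass hx hy ha
  · refine hsplit.top_le D (S := (D.Iclass α).comap (D.mu.flip m)) (fun k a hak ha => ?_)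
      (Submodule.mem_top (x := n))
    refine D.Iclass_le (S := (D.Iclass α).comap (D.mu a))
      (fun i x _ hx => (ha.mul_mem_Iclass D hx).2) (fun i j x hxi y hyj hx hy => ⟨?_, ?_⟩) hm
    · exact D.mu_br_mem_Iclass' hx hxi hy hyj ha
    · exact D.mu_mu_mem_Iclass' hx hy ha

end BHPS

namespace BHPS

variable {K A : Type*}

/-- `I_{[α]}` is an ideal of `A`. -/
theorem Iclass_isIdeal {K A : Type*} [Field K] [AddCommGroup A] [Module K A] (D : BHPS K A)
    (hsplit : D.IsSplit)
    (α : Module.Dual K ↥D.H0) (hα : α ∈ D.roots) :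
    D.IsIdeal (D.Iclass α) := by
  obtain ⟨h₁, h₂, h₃⟩ := D.Iclass_mul_le (α := α) hsplit
  exact ⟨le_top, D.Iclass_graded, h₁, h₂, h₃, D.map_phi_Iclass, D.map_psi_Iclass⟩

end BHPS
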